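/- Let C ⊆ ℝ^d be a cone with nonempty interior and Φ : [0,∞) × ℝ^d → ℝ^d a C¹-smooth strongly monotone semiflow with compact orbit closures such that, for some t₀ > 0, DΦ_{t₀}(e) is strongly positive at every equilibrium e. Then the set S_Φ := {x ∈ ℝ^d : λ_max(x,Φ) > 0} has Lebesgue measure zero in ℝ^d; in particular Φ has no observable chaos. -/

import Mathlib

open Filter Topology MeasureTheory Set Bornology Metric
open scoped ENNReal NNReal

noncomputable section

section Defs

variable {X : Type*} [NormedAddCommGroup X] [NormedSpace ℝ X]

/-- A cone in a Banach space: a closed convex set with `r • C ⊆ C` for all `r > 0`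
and `C ∩ (-C) = {0}`. -/
def IsCone (C : Set X) : Prop :=
  IsClosed C ∧ Convex ℝ C ∧ (∀ r : ℝ, 0 < r → ∀ x ∈ C, r • x ∈ C) ∧ C ∩ (-C) = {0}

/-- `(X, C)` is strongly ordered: `C` is a cone with nonempty interior. -/
def StronglyOrderedCone (C : Set X) : Prop :=
  IsCone C ∧ (interior C).Nonempty

/-- `x < y` in the order induced by the cone `C`. -/
def coneLT (C : Set X) (x y : X) : Prop := y - x ∈ C \ {0}

/-- `x ≤ y` in the order induced by the cone `C`. -/
def coneLE (C : Set X) (x y : X) : Prop := y - x ∈ C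

/-- `x ≪ y` in the order induced by the cone `C`. -/
def coneLLT (C : Set X) (x y : X) : Prop := y - x ∈ interior C

/-- A bounded linear operator is strongly positive (w.r.t. the cone `C`) if
`T v ≫ 0` whenever `v > 0`. -/
def StronglyPositive (C : Set X) (T : X →L[ℝ] X) : Prop :=
  ∀ v : X, v ∈ C \ {0} → T v ∈ interior C

/-- A map between normed spaces is compact if it sends bounded sets to relatively
compact sets. -/
def IsCompactMap {Y Z : Type*} [NormedAddCommGroup Y] [NormedAddCommGroup Z]
    (f : Y → Z) : Prop :=
  ∀ B : Set Y, IsBounded B → IsCompact (closure (f '' B))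

/-- `h` is pointwise dissipative: some nonempty bounded set `B` attracts every point. -/
def PointwiseDissipative (h : X → X) : Prop :=
  ∃ B : Set X, B.Nonempty ∧ IsBounded B ∧
    ∀ x : X, Tendsto (fun n : ℕ => infDist (h^[n] x) B) atTop (nhds 0)

/-- The set `A` attracts the set `B` under iteration of `h`. -/
def AttractsSet (h : X → X) (A B : Set X) : Prop :=
  ∀ ε : ℝ, 0 < ε → ∃ N : ℕ, ∀ n : ℕ, N ≤ n → ∀ x ∈ B, infDist (h^[n] x) A < ε

/-- `A` is an attractor of `h`: the maximal compact invariant set attracting every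
bounded set. -/
def IsAttractor (h : X → X) (A : Set X) : Prop :=
  A.Nonempty ∧ IsCompact A ∧ h '' A = A ∧
    (∀ B : Set X, IsBounded B → AttractsSet h A B) ∧
    (∀ A' : Set X, IsCompact A' → h '' A' = A' → A' ⊆ A)

/-- The ω-limit set `ω(x,h) = ⋂ₖ closure {hⁿ x : n ≥ k}`. -/
def omegaMap (h : X → X) (x : X) : Set X :=
  ⋂ k : ℕ, closure {y : X | ∃ n : ℕ, k ≤ n ∧ y = h^[n] x}

/-- The largest Lyapunov exponent `λ_max(x,h) = liminf (log ‖Dhⁿ(x)‖)/n` (in `EReal`). -/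
def lambdaMax (h : X → X) (x : X) : EReal :=
  atTop.liminf fun n : ℕ => ((Real.log ‖fderiv ℝ (h^[n]) x‖ / n : ℝ) : EReal)

/-- The principal Lyapunov exponent `λ₁(x,h) = limsup (log ‖Dhⁿ(x)‖)/n` (in `EReal`). -/
def lambdaOne (h : X → X) (x : X) : EReal :=
  atTop.limsup fun n : ℕ => ((Real.log ‖fderiv ℝ (h^[n]) x‖ / n : ℝ) : EReal)

/-- `S` is a linearly stable cycle of `h` of minimal period `p`: `S` is the orbit of a
`p`-periodic point `z` with spectral radius of `Dhᵖ(z)` at most `1`. -/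
def IsLinStableCycle (h : X → X) (p : ℕ) (S : Set X) : Prop :=
  ∃ z : X, h^[p] z = z ∧ (∀ l : ℕ, 0 < l → l < p → h^[l] z ≠ z) ∧
    spectralRadius ℝ (fderiv ℝ (h^[p]) z) ≤ 1 ∧ S = {y : X | ∃ n : ℕ, y = h^[n] z}

/-- `S` is a linearly stable cycle of `h` of minimal period at most `m`. -/
def IsLinStableCycleLe (h : X → X) (m : ℕ) (S : Set X) : Prop :=
  ∃ p : ℕ, 0 < p ∧ p ≤ m ∧ IsLinStableCycle h p S

/-- Semiflow axioms for `Φ : ℝ → X → X` (restricted to nonnegative times). -/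
def IsSemiflow (Φ : ℝ → X → X) : Prop :=
  (∀ x : X, Φ 0 x = x) ∧
    (∀ s t : ℝ, 0 ≤ s → 0 ≤ t → ∀ x : X, Φ (t + s) x = Φ t (Φ s x)) ∧
    ContinuousOn (fun p : ℝ × X => Φ p.1 p.2) (Ici (0 : ℝ) ×ˢ (univ : Set X))

/-- The ω-limit set of `x` under a semiflow. -/
def omegaFlow (Φ : ℝ → X → X) (x : X) : Set X :=
  ⋂ s : ℝ, closure {y : X | ∃ t : ℝ, s ≤ t ∧ y = Φ t x}

/-- The largest Lyapunov exponent of `x` w.r.t. a semiflow. -/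
def lambdaMaxFlow (Φ : ℝ → X → X) (x : X) : EReal :=
  atTop.liminf fun t : ℝ => ((Real.log ‖fderiv ℝ (Φ t) x‖ / t : ℝ) : EReal)

/-- The principal Lyapunov exponent of `x` w.r.t. a semiflow. -/
def lambdaOneFlow (Φ : ℝ → X → X) (x : X) : EReal :=
  atTop.limsup fun t : ℝ => ((Real.log ‖fderiv ℝ (Φ t) x‖ / t : ℝ) : EReal)

end Defs

section Shy

variable {X : Type*} [NormedAddCommGroup X] [NormedSpace ℝ X] [MeasurableSpace X]

/-- A Borel set `W` is shy if there is a nonzero compactly supported Borel measure `μ`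
with `μ(x + W) = 0` for every `x`. -/
def IsShy (W : Set X) : Prop :=
  MeasurableSet W ∧
    ∃ μ : Measure X, μ ≠ 0 ∧ (∃ K : Set X, IsCompact K ∧ μ Kᶜ = 0) ∧
      ∀ x : X, μ ((fun w => x + w) '' W) = 0

/-- `W` is prevalent in `V` if `V \ W` is shy. -/
def IsPrevalentIn (V W : Set X) : Prop := IsShy (V \ W)

end Shy

section PositiveCone

variable {X : Type*} [NormedAddCommGroup X] [NormedSpace ℝ X] {C : Set X}

lemma IsCone.zero_mem (hC : IsCone C) : (0 : X) ∈ C := by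
  have h : (0 : X) ∈ C ∩ (-C) := by rw [hC.2.2.2]; rfl
  exact h.1

/-- A nonzero element of a cone is detected by a functional that is nonnegative on the cone. -/
lemma IsCone.exists_nonneg_functional_pos (hC : IsCone C) {y : X} (hy : y ∈ C) (hy0 : y ≠ 0) :
    ∃ f : X →L[ℝ] ℝ, (∀ x ∈ C, 0 ≤ f x) ∧ 0 < f y := by
  have hny : -y ∉ C := fun h => by
    have : y ∈ C ∩ (-C) := ⟨hy, h⟩
    rw [hC.2.2.2] at this
    exact hy0 this
  obtain ⟨f, u, hfu, hf⟩ := geometric_hahn_banach_point_closed hC.2.1 hC.1 hny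
  have hu : u < 0 := by simpa using hf 0 hC.zero_mem
  refine ⟨f, fun x hx => ?_, ?_⟩
  · by_contra! hneg
    have h := hf _ (hC.2.2.1 (u / f x) (div_pos_of_neg_of_neg hu hneg) x hx)
    rw [map_smul, smul_eq_mul, div_mul_cancel₀ _ hneg.ne] at h
    exact lt_irrefl _ h
  · rw [map_neg] at hfu
    linarith

/-- In finite dimensions a cone admits a uniformly positive functional. -/
lemma IsCone.exists_functional_norm_le [FiniteDimensional ℝ X] (hC : IsCone C) :
    ∃ (f : X →L[ℝ] ℝ) (c : ℝ), 0 < c ∧ ∀ x ∈ C, ‖x‖ ≤ c * f x := by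
  have hS : IsCompact (C ∩ sphere (0 : X) 1) :=
    (isCompact_sphere (0 : X) 1).inter_left hC.1
  obtain ⟨f, -, hf⟩ : ∃ f : X →L[ℝ] ℝ, (∀ x ∈ C, 0 ≤ f x) ∧
      ∀ x ∈ C ∩ sphere (0 : X) 1, 0 < f x := by
    refine hS.induction_on
      (p := fun s => ∃ f : X →L[ℝ] ℝ, (∀ x ∈ C, 0 ≤ f x) ∧ ∀ x ∈ C ∩ s, 0 < f x) ?_ ?_ ?_ ?_
      |>.imp fun f hf => ⟨hf.1, fun x hx => hf.2 x ⟨hx.1, hx⟩⟩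
    · exact ⟨0, by simp, by simp⟩
    · rintro s t hst ⟨f, hf, hft⟩
      exact ⟨f, hf, fun x hx => hft x ⟨hx.1, hst hx.2⟩⟩
    · rintro s t ⟨f, hf, hfs⟩ ⟨g, hg, hgt⟩
      refine ⟨f + g, fun x hx => add_nonneg (hf x hx) (hg x hx), ?_⟩
      rintro x ⟨hx, hxs | hxt⟩
      · exact add_pos_of_pos_of_nonneg (hfs x ⟨hx, hxs⟩) (hg x hx)
      · exact add_pos_of_nonneg_of_pos (hf x hx) (hgt x ⟨hx, hxt⟩)
    · rintro y ⟨hy, hy1⟩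
      obtain ⟨f, hf, hfy⟩ := hC.exists_nonneg_functional_pos hy (ne_of_mem_sphere hy1 one_ne_zero)
      exact ⟨{x | 0 < f x}, mem_nhdsWithin_of_mem_nhds
        ((isOpen_lt continuous_const f.continuous).mem_nhds hfy), f, hf, fun x hx => hx.2⟩
  obtain ⟨m, hm, hmf⟩ : ∃ m : ℝ, 0 < m ∧ ∀ x ∈ C ∩ sphere (0 : X) 1, m ≤ f x :=
    hS.exists_forall_le' f.continuous.continuousOn hf
  refine ⟨f, m⁻¹, inv_pos.2 hm, fun x hx => ?_⟩
  rcases eq_or_ne x 0 with rfl | hx0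
  · simp
  have hnx : 0 < ‖x‖ := norm_pos_iff.2 hx0
  have h := hmf (‖x‖⁻¹ • x) ⟨hC.2.2.1 _ (inv_pos.2 hnx) x hx, by
    rw [mem_sphere_zero_iff_norm, norm_smul, norm_inv, norm_norm, inv_mul_cancel₀ hnx.ne']⟩
  rw [map_smul, smul_eq_mul, le_inv_mul_iff₀ hnx] at h
  rw [le_inv_mul_iff₀ hm]
  linarith

/-- The operator norm of an operator preserving a cone is controlled by its value at an interior
point of the cone. -/
lemma exists_opNorm_le_of_mem_interior {v : X} (hv : v ∈ interior C) {f : X →L[ℝ] ℝ}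
    {c : ℝ} (hc : 0 < c) (hf : ∀ x ∈ C, ‖x‖ ≤ c * f x) :
    ∃ K : ℝ, 0 ≤ K ∧ ∀ T : X →L[ℝ] X, (∀ u ∈ C, T u ∈ C) → ‖T‖ ≤ K * f (T v) := by
  obtain ⟨r, hr, hball⟩ := Metric.isOpen_iff.1 isOpen_interior v hv
  have hmem : ∀ w : X, ‖w‖ < r → v + w ∈ C := fun w hw =>
    interior_subset (hball (by simpa [mem_ball_iff_norm] using hw))
  have hnonneg : ∀ x ∈ C, 0 ≤ f x := fun x hx =>
    nonneg_of_mul_nonneg_right ((norm_nonneg x).trans (hf x hx)) hc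
  refine ⟨2 / r * (3 * c), by positivity, fun T hT => ?_⟩
  have hTv := hT v (interior_subset hv)
  have hfTv := hnonneg _ hTv
  refine T.opNorm_le_bound (by positivity) fun w => ?_
  rcases eq_or_ne w 0 with rfl | hw0
  · simp
  have hnw : 0 < ‖w‖ := norm_pos_iff.2 hw0
  set a : ℝ := r / (2 * ‖w‖) with ha
  have ha0 : 0 < a := by positivity
  have hanorm : ‖a • w‖ < r := by
    rw [norm_smul, Real.norm_of_nonneg ha0.le, ha]
    field_simp
    linarith
  have hplus := hT _ (hmem _ hanorm)
  have hminus := hT _ (hmem (-(a • w)) (by rwa [norm_neg]))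
  have h1 := hf _ hplus
  have h2 := hnonneg _ hminus
  have h3 := hf _ hTv
  rw [map_add] at h1
  simp only [map_add, map_neg, map_smul, smul_eq_mul] at h1 h2
  have h4 : a * ‖T w‖ ≤ ‖T v + a • T w‖ + ‖T v‖ := by
    calc a * ‖T w‖ = ‖(T v + a • T w) - T v‖ := by
          rw [add_sub_cancel_left, norm_smul, Real.norm_of_nonneg ha0.le]
      _ ≤ _ := norm_sub_le _ _
  have h5 : a * ‖T w‖ ≤ 3 * c * f (T v) := by nlinarith
  have h6 : ‖T w‖ ≤ (3 * c * f (T v)) / a := by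
    rw [le_div_iff₀ ha0]
    linarith
  refine h6.trans (le_of_eq ?_)
  rw [ha]
  field_simp

/-- The derivative of an order-preserving map preserves the cone. -/
lemma IsCone.fderiv_apply_mem (hC : IsCone C) {g : X → X}
    (hg : ∀ x y, coneLE C x y → coneLE C (g x) (g y)) {x : X} (hd : DifferentiableAt ℝ g x)
    {u : X} (hu : u ∈ C) : fderiv ℝ g x u ∈ C := by
  refine hC.1.mem_of_tendsto (hd.hasFDerivAt.hasLineDerivAt u).tendsto_slope_zero_right ?_
  filter_upwards [self_mem_nhdsWithin] with s hs
  refine hC.2.2.1 _ (inv_pos.2 hs) _ (hg _ _ ?_)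
  simpa [coneLE] using hC.2.2.1 s hs u hu

end PositiveCone

section LineIntegral

variable {X : Type*} [NormedAddCommGroup X] [NormedSpace ℝ X]

lemma setLIntegral_fderiv_norm_le {g : X → X} (hg : ContDiff ℝ 1 g) {f : X →L[ℝ] ℝ} {K : ℝ}
    (hK : 0 ≤ K) {v : X} (hle : ∀ x, ‖fderiv ℝ g x‖ ≤ K * f (fderiv ℝ g x v)) (y : X) {a b B : ℝ}
    (hab : a ≤ b) (ha : |f (g (y + a • v))| ≤ B) (hb : |f (g (y + b • v))| ≤ B) :
    ∫⁻ s in Icc a b, ENNReal.ofReal ‖fderiv ℝ g (y + s • v)‖ ≤ ENNReal.ofReal (K * (2 * B)) := by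
  have hline : Continuous fun s : ℝ => y + s • v := by fun_prop
  have hfd : Continuous fun s : ℝ => fderiv ℝ g (y + s • v) :=
    (hg.continuous_fderiv one_ne_zero).comp hline
  have hder : ∀ s : ℝ, HasDerivAt (fun s : ℝ => f (g (y + s • v)))
      (f (fderiv ℝ g (y + s • v) v)) s := fun s => by
    have h1 : HasDerivAt (fun s : ℝ => y + s • v) v s := by
      simpa using ((hasDerivAt_id s).smul_const v).const_add y
    have h2 := (hg.differentiable one_ne_zero (y + s • v)).hasFDerivAt.comp_hasDerivAt s h1
    exact f.hasFDerivAt.comp_hasDerivAt s h2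
  have hcont : Continuous fun s : ℝ => f (fderiv ℝ g (y + s • v) v) := by fun_prop
  have hint : ∫ s in a..b, f (fderiv ℝ g (y + s • v) v) =
      f (g (y + b • v)) - f (g (y + a • v)) :=
    intervalIntegral.integral_eq_sub_of_hasDerivAt (fun s _ => hder s)
      (hcont.intervalIntegrable a b)
  rw [← ofReal_integral_eq_lintegral_ofReal (hfd.norm.continuousOn.integrableOn_Icc)
    (ae_of_all _ fun s => norm_nonneg _)]
  refine ENNReal.ofReal_le_ofReal ?_
  rw [integral_Icc_eq_integral_Ioc, ← intervalIntegral.integral_of_le hab]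
  calc ∫ s in a..b, ‖fderiv ℝ g (y + s • v)‖
      ≤ ∫ s in a..b, K * f (fderiv ℝ g (y + s • v) v) :=
        intervalIntegral.integral_mono_on hab (hfd.norm.intervalIntegrable a b)
          ((hcont.const_mul K).intervalIntegrable a b) fun s _ => hle _
    _ = K * (f (g (y + b • v)) - f (g (y + a • v))) := by
        rw [intervalIntegral.integral_const_mul, hint]
    _ ≤ K * (2 * B) := by
        refine mul_le_mul_of_nonneg_left ?_ hK
        linarith [abs_le.1 ha, abs_le.1 hb]

end LineIntegral

/-- A sequence of functions with bounded `L¹` norms grows subexponentially almost everywhere. -/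
lemma ae_tsum_exp_mul_lt_top {α : Type*} [MeasurableSpace α] {μ : Measure α} {D : ℕ → α → ℝ≥0∞}
    (hD : ∀ n, Measurable (D n)) {M : ℝ≥0∞} (hM : M ≠ ⊤) (hDM : ∀ n, ∫⁻ x, D n x ∂μ ≤ M) {ε : ℝ}
    (hε : 0 < ε) :
    ∀ᵐ x ∂μ, ∑' n : ℕ, ENNReal.ofReal (Real.exp (-ε * n)) * D n x < ⊤ := by
  refine ae_lt_top (Measurable.tsum fun n => (hD n).const_mul _) (ne_of_lt ?_)
  rw [lintegral_tsum fun n => ((hD n).const_mul _).aemeasurable]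
  calc ∑' n : ℕ, ∫⁻ x, ENNReal.ofReal (Real.exp (-ε * n)) * D n x ∂μ
      ≤ ∑' n : ℕ, ENNReal.ofReal (Real.exp (-ε * n)) * M := by
        refine ENNReal.tsum_le_tsum fun n => ?_
        rw [lintegral_const_mul _ (hD n)]
        gcongr
        exact hDM n
    _ = (∑' n : ℕ, ENNReal.ofReal (Real.exp (-ε * n))) * M := ENNReal.tsum_mul_right
    _ < ⊤ := by
        refine ENNReal.mul_lt_top ?_ hM.lt_top
        have hs : Summable fun n : ℕ => Real.exp (-ε * n) := by
          simpa [mul_comm] using Real.summable_exp_nat_mul_iff.2 (neg_lt_zero.2 hε)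
        rw [← ENNReal.ofReal_tsum_of_nonneg (fun n => (Real.exp_pos _).le) hs]
        exact ENNReal.ofReal_lt_top

lemma lambdaMaxFlow_le_of_tsum_lt_top {X : Type*} [NormedAddCommGroup X] [NormedSpace ℝ X]
    {Φ : ℝ → X → X} {x : X} {ε : ℝ} (hε : 0 < ε)
    (h : ∑' n : ℕ, ENNReal.ofReal (Real.exp (-ε * n)) *
      ENNReal.ofReal ‖fderiv ℝ (Φ (n + 1)) x‖ < ⊤) :
    lambdaMaxFlow Φ x ≤ (2 * ε : ℝ) := by
  have hto : Tendsto (fun n : ℕ => (n + 1 : ℝ)) atTop atTop :=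
    tendsto_atTop_add_const_right _ _ tendsto_natCast_atTop_atTop
  have hlim := ENNReal.tendsto_atTop_zero_of_tsum_ne_top h.ne
  refine liminf_le_of_frequently_le' (hto.frequently ?_)
  refine Eventually.frequently ?_
  filter_upwards [hlim.eventually (gt_mem_nhds one_pos)] with n hn
  rw [← ENNReal.ofReal_mul (Real.exp_pos _).le, ENNReal.ofReal_lt_one] at hn
  rw [EReal.coe_le_coe_iff, div_le_iff₀ (by positivity)]
  have hn0 : (0 : ℝ) ≤ n := n.cast_nonneg
  rcases (norm_nonneg (fderiv ℝ (Φ (n + 1)) x)).eq_or_lt with h0 | h0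
  · rw [← h0, Real.log_zero]
    positivity
  · have hlog := Real.log_lt_log (mul_pos (Real.exp_pos _) h0) hn
    rw [Real.log_mul (Real.exp_pos _).ne' h0.ne', Real.log_exp, Real.log_one] at hlog
    nlinarith

/-- Almost every point of an order-preserving `C¹` semiflow with bounded orbits has nonpositive
largest Lyapunov exponent. -/
lemma ae_lambdaMaxFlow_le_zero {X : Type*} [NormedAddCommGroup X] [NormedSpace ℝ X]
    [FiniteDimensional ℝ X] [MeasurableSpace X] [BorelSpace X] (μ : Measure X) [μ.IsAddHaarMeasure]
    {C : Set X} (hC : StronglyOrderedCone C) {Φ : ℝ → X → X}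
    (hC1 : ∀ t : ℝ, 0 < t → ContDiff ℝ 1 (Φ t))
    (hmono : ∀ t : ℝ, 0 < t → ∀ x y : X, coneLE C x y → coneLE C (Φ t x) (Φ t y))
    (horb : ∀ x : X, IsBounded {y : X | ∃ t : ℝ, 0 ≤ t ∧ y = Φ t x}) :
    ∀ᵐ x ∂μ, lambdaMaxFlow Φ x ≤ 0 := by
  obtain ⟨hC, v, hv⟩ := hC
  obtain ⟨f, c, hc, hf⟩ := hC.exists_functional_norm_le
  obtain ⟨K, hK, hKT⟩ := exists_opNorm_le_of_mem_interior hv hc hf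
  have hpos : ∀ n : ℕ, (0 : ℝ) < n + 1 := fun n => by positivity
  have hnorm : ∀ (n : ℕ) (x : X),
      ‖fderiv ℝ (Φ (n + 1)) x‖ ≤ K * f (fderiv ℝ (Φ (n + 1)) x v) := fun n x =>
    hKT _ fun u hu => hC.fderiv_apply_mem (hmono _ (hpos n))
      ((hC1 _ (hpos n)).differentiable one_ne_zero x) hu
  have hcont : ∀ n : ℕ, Continuous fun x => ENNReal.ofReal ‖fderiv ℝ (Φ (n + 1)) x‖ := fun n =>
    ENNReal.continuous_ofReal.comp ((hC1 _ (hpos n)).continuous_fderiv one_ne_zero).norm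
  have hbound : ∀ x : X, ∃ B : ℝ, ∀ n : ℕ, |f (Φ (n + 1) x)| ≤ B := fun x => by
    obtain ⟨R, hR⟩ := (horb x).exists_norm_le
    refine ⟨‖f‖ * R, fun n => (f.le_opNorm _).trans ?_⟩
    exact mul_le_mul_of_nonneg_left (hR _ ⟨n + 1, (hpos n).le, rfl⟩) (norm_nonneg f)
  have key : ∀ ε : ℝ, 0 < ε → ∀ᵐ x ∂μ, lambdaMaxFlow Φ x ≤ (2 * ε : ℝ) := fun ε hε => by
    let s : Set X := {x | ∑' n : ℕ, ENNReal.ofReal (Real.exp (-ε * n)) *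
      ENNReal.ofReal ‖fderiv ℝ (Φ (n + 1)) x‖ < ⊤}
    have hs : MeasurableSet s := measurableSet_lt
      (Measurable.tsum fun n => (hcont n).measurable.const_mul _) measurable_const
    have hae : ∀ᵐ x ∂μ, x ∈ s := by
      refine ae_mem_of_ae_add_linearMap_mem (LinearMap.toSpanSingleton ℝ X v) volume μ hs
        fun y => ?_
      have hcover : (⋃ m : ℕ, Icc (-m : ℝ) m) = univ := by
        refine eq_univ_of_forall fun t => mem_iUnion.2 ?_
        obtain ⟨m, hm⟩ := exists_nat_ge |t|
        exact ⟨m, abs_le.1 hm⟩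
      rw [← Measure.restrict_univ (μ := (volume : Measure ℝ)), ← hcover, ae_restrict_iUnion_iff]
      intro m
      obtain ⟨B₁, hB₁⟩ := hbound (y + (-m : ℝ) • v)
      obtain ⟨B₂, hB₂⟩ := hbound (y + (m : ℝ) • v)
      have hline : Continuous fun t : ℝ => y + t • v := by fun_prop
      exact ae_tsum_exp_mul_lt_top (fun n => ((hcont n).comp hline).measurable)
        ENNReal.ofReal_ne_top
        (fun n => setLIntegral_fderiv_norm_le (hC1 _ (hpos n)) hK (hnorm n) y
          (neg_le_self m.cast_nonneg) ((hB₁ n).trans (le_max_left B₁ B₂))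
          ((hB₂ n).trans (le_max_right B₁ B₂))) hε
    filter_upwards [hae] with x hx using lambdaMaxFlow_le_of_tsum_lt_top hε hx
  have hall : ∀ᵐ x ∂μ, ∀ k : ℕ, lambdaMaxFlow Φ x ≤ (2 * (1 / ((k : ℝ) + 1)) : ℝ) :=
    ae_all_iff.2 fun k => key _ (by positivity)
  filter_upwards [hall] with x hx
  have hlim : Tendsto (fun k : ℕ => 2 * (1 / ((k : ℝ) + 1))) atTop (𝓝 0) := by
    simpa using (tendsto_one_div_add_atTop_nhds_zero_nat (𝕜 := ℝ)).const_mul 2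
  exact ge_of_tendsto' ((continuous_coe_real_ereal.tendsto 0).comp hlim) hx

/-- **Theorem C**, finite-dimensional form: `S_Φ` has Lebesgue measure zero in `ℝ^d`;
in particular `Φ` has no observable chaos. -/
theorem no_observable_chaos_semiflow_Rd
    {d : ℕ} (C : Set (EuclideanSpace ℝ (Fin d))) (hC : StronglyOrderedCone C)
    (Φ : ℝ → EuclideanSpace ℝ (Fin d) → EuclideanSpace ℝ (Fin d)) (hΦ : IsSemiflow Φ)
    (hC1 : ∀ t : ℝ, 0 < t → ContDiff ℝ 1 (Φ t))
    (hmono : ∀ t : ℝ, 0 < t → ∀ x y : EuclideanSpace ℝ (Fin d),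
      coneLT C x y → coneLLT C (Φ t x) (Φ t y))
    (horb : ∀ x : EuclideanSpace ℝ (Fin d), IsCompact (closure {y : EuclideanSpace ℝ (Fin d) | ∃ t : ℝ, 0 ≤ t ∧ y = Φ t x}))
    (t₀ : ℝ) (ht₀ : 0 < t₀)
    (hposD : ∀ e : EuclideanSpace ℝ (Fin d), (∀ t : ℝ, 0 ≤ t → Φ t e = e) →
      StronglyPositive C (fderiv ℝ (Φ t₀) e)) :
    volume {x : EuclideanSpace ℝ (Fin d) | 0 < lambdaMaxFlow Φ x} = 0 ∧
      ¬ ∃ E : Set (EuclideanSpace ℝ (Fin d)),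
          MeasurableSet E ∧ 0 < volume E ∧ ∀ x ∈ E, 0 < lambdaMaxFlow Φ x := by
  have hle : ∀ t : ℝ, 0 < t → ∀ x y, coneLE C x y → coneLE C (Φ t x) (Φ t y) := by
    intro t ht x y hxy
    rcases eq_or_ne x y with rfl | hne
    · simpa [coneLE] using hC.1.zero_mem
    · exact interior_subset (hmono t ht x y ⟨hxy, sub_ne_zero.2 hne.symm⟩)
  have hzero : volume {x : EuclideanSpace ℝ (Fin d) | 0 < lambdaMaxFlow Φ x} = 0 := by
    have h := ae_lambdaMaxFlow_le_zero volume hC hC1 hle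
      fun x => (horb x).isBounded.subset subset_closure
    simpa only [ae_iff, not_le] using h
  exact ⟨hzero, fun ⟨E, _, hE, hsub⟩ => hE.ne' (measure_mono_null hsub hzero)⟩

end
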